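/- arXiv:1509.02643 — 2 statements merged into one kernel-verified Lean document; each statement's English description precedes it below -/
import Mathlib

section
/- Let A be a C*-algebra, let B be a nonzero hereditary C*-subalgebra of A, and let π be an irreducible representation of A on a complex Hilbert space H such that π(B) ≠ {0} and the closed linear span K_π(B) of {π(b)x : b ∈ B, x ∈ H} is a proper subspace of H. Then for every t ∈ (0,1] and every unit vector x ∈ K_π(B), there exists a unit vector h ∈ H such that ⟨h, π(b)h⟩ = t·⟨x, π(b)x⟩ for all b ∈ B; in particular, the pure state ω_h^π of A restricts on B to t times the pure state b ↦ ⟨x, π(b)x⟩ of B. -/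
open scoped ComplexOrder InnerProductSpace

noncomputable section

variable (A : Type*) [NonUnitalNormedRing A] [NormedSpace ℂ A] [StarRing A]

/-- A state on a C*-algebra: a continuous linear functional which is positive
(`φ (a* a) ≥ 0` in the complex order) and of norm one. -/
def IsState (φ : A →L[ℂ] ℂ) : Prop :=
  (∀ a : A, 0 ≤ φ (star a * a)) ∧ ‖φ‖ = 1

/-- A pure state: an extreme point of the set of states. -/
def IsPureState (φ : A →L[ℂ] ℂ) : Prop :=
  φ ∈ Set.extremePoints ℝ {ψ : A →L[ℂ] ℂ | IsState A ψ}

section Hereditary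

variable [PartialOrder A] [StarOrderedRing A]

/-- A hereditary C*-subalgebra: a closed *-subalgebra `B` such that
`0 ≤ a ≤ b` with `b ∈ B` implies `a ∈ B`. -/
def IsHereditary (B : NonUnitalStarSubalgebra ℂ A) : Prop :=
  IsClosed (B : Set A) ∧ ∀ a : A, ∀ b ∈ B, 0 ≤ a → a ≤ b → a ∈ B

end Hereditary

variable {H : Type*} [NormedAddCommGroup H] [InnerProductSpace ℂ H] [CompleteSpace H]

/-- Irreducibility of a representation: the space is nonzero and the only closed
invariant subspaces are `⊥` and `⊤`. -/
def IsIrredRep (π : A →⋆ₙₐ[ℂ] (H →L[ℂ] H)) : Prop :=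
  (∃ x : H, x ≠ 0) ∧
  ∀ K : Submodule ℂ H, IsClosed (K : Set H) → (∀ a : A, ∀ x ∈ K, π a x ∈ K) → K = ⊥ ∨ K = ⊤

/-- `K_π(S)`: the closed linear span of `{π b x : b ∈ S, x ∈ H}`. -/
def repSpan (π : A →⋆ₙₐ[ℂ] (H →L[ℂ] H)) (S : Set A) : Submodule ℂ H :=
  (Submodule.span ℂ {y : H | ∃ b ∈ S, ∃ x : H, y = π b x}).topologicalClosure


/-- The positive linear functional underlying a continuous linear functional that is nonnegative
on all `star a * a`. -/
def positiveLinearMapOfNonneg {A : Type*} [NonUnitalCStarAlgebra A] [PartialOrder A]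
    [StarOrderedRing A] (ψ : A →L[ℂ] ℂ) (hψ : ∀ a : A, 0 ≤ ψ (star a * a)) : A →ₚ[ℂ] ℂ :=
  PositiveLinearMap.mk₀ (ψ : A →ₗ[ℂ] ℂ) fun a ha ↦ by
    obtain ⟨b, rfl⟩ := CStarAlgebra.nonneg_iff_eq_star_mul_self.mp (show 0 ≤ a from ha)
    exact hψ b

/-- Two continuous functionals on a C*-algebra that agree on all `star a * a` are equal. -/
lemma ContinuousLinearMap.eq_of_eq_star_mul_self {A : Type*} [NonUnitalCStarAlgebra A]
    {φ ψ : A →L[ℂ] ℂ} (h : ∀ a : A, φ (star a * a) = ψ (star a * a)) : φ = ψ := by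
  let _ := CStarAlgebra.spectralOrder A
  have _ := CStarAlgebra.spectralOrderedRing A
  ext a
  have ha : a ∈ Submodule.span ℂ {a : A | 0 ≤ a} := by simp [CStarAlgebra.span_nonneg]
  induction ha using Submodule.span_induction with
  | mem a ha =>
    obtain ⟨b, rfl⟩ := CStarAlgebra.nonneg_iff_eq_star_mul_self.mp (show 0 ≤ a from ha)
    exact h b
  | zero => simp
  | add a b _ _ ha hb => simp [ha, hb]
  | smul c a _ ha => simp [ha]

/-- In an irreducible representation that does not vanish, every nonzero vector is cyclic. -/
lemma IsIrredRep.denseRange_apply {A : Type*} [NonUnitalCStarAlgebra A]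
    {H : Type*} [NormedAddCommGroup H] [InnerProductSpace ℂ H] [CompleteSpace H]
    {π : A →⋆ₙₐ[ℂ] (H →L[ℂ] H)} (hπ : IsIrredRep A π) (hπ0 : ∃ a, π a ≠ 0)
    {h : H} (hh : h ≠ 0) : DenseRange fun a : A ↦ π a h := by
  have hnd : ∃ a, π a h ≠ 0 := by
    by_contra! hcon
    let N : Submodule ℂ H := ⨅ a : A, LinearMap.ker (π a : H →ₗ[ℂ] H)
    have hN : ∀ x, x ∈ N ↔ ∀ a, π a x = 0 := fun x ↦ by simp [N]
    have hclosed : IsClosed (N : Set H) := by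
      have : (N : Set H) = ⋂ a : A, {x | π a x = 0} := by
        ext x
        simp [hN]
      rw [this]
      exact isClosed_iInter fun a ↦ isClosed_eq (π a).continuous continuous_const
    rcases hπ.2 N hclosed (fun a x hx ↦ by simp [(hN x).1 hx a]) with hbot | htop
    · exact hh (by simpa [hbot] using (hN h).2 hcon)
    · obtain ⟨a, ha⟩ := hπ0
      exact ha (ContinuousLinearMap.ext fun x ↦ (hN x).1 (by simp [htop]) a)
  let q : A →ₗ[ℂ] H := (ContinuousLinearMap.apply ℂ H h : (H →L[ℂ] H) →ₗ[ℂ] H) ∘ₗ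
    (π : A →ₗ[ℂ] (H →L[ℂ] H))
  have hq : ∀ a, q a = π a h := fun a ↦ rfl
  let K := (LinearMap.range q).topologicalClosure
  have hinv : ∀ a : A, ∀ x ∈ K, π a x ∈ K := fun a x hx ↦ by
    refine map_mem_closure (π a).continuous hx ?_
    rintro _ ⟨b, rfl⟩
    exact ⟨a * b, by simp [hq]⟩
  have hK : K = ⊤ := by
    refine (hπ.2 K (Submodule.isClosed_topologicalClosure _) hinv).resolve_left fun hbot ↦ ?_
    obtain ⟨a, ha⟩ := hnd
    have : π a h ∈ K := Submodule.le_topologicalClosure _ ⟨a, rfl⟩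
    rw [hbot] at this
    exact ha (by simpa using this)
  intro x
  have : x ∈ K := by simp [hK]
  exact this

/-- Schur's lemma: a self-adjoint operator commuting with an irreducible representation is a
scalar. -/
lemma IsIrredRep.eq_smul_one_of_commute {A : Type*} [NonUnitalCStarAlgebra A]
    {H : Type*} [NormedAddCommGroup H] [InnerProductSpace ℂ H] [CompleteSpace H]
    {π : A →⋆ₙₐ[ℂ] (H →L[ℂ] H)} (hπ : IsIrredRep A π)
    {T : H →L[ℂ] H} (hT : IsSelfAdjoint T) (hcomm : ∀ a, Commute T (π a)) :
    ∃ r : ℝ, T = (r : ℂ) • (1 : H →L[ℂ] H) := by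
  have hsub : (spectrum ℝ T).Subsingleton := by
    intro l hl m hm
    by_contra hlm
    wlog hlt : l < m generalizing l m
    · exact this hm hl (Ne.symm hlm) (lt_of_le_of_ne (not_lt.mp hlt) (Ne.symm hlm))
    let c := (l + m) / 2
    let f : ℝ → ℝ := fun x ↦ max (x - c) 0
    let g : ℝ → ℝ := fun x ↦ max (c - x) 0
    have hf : Continuous f := by fun_prop
    have hg : Continuous g := by fun_prop
    have hfg : cfc f T * cfc g T = 0 := by
      rw [← cfc_mul f g T hf.continuousOn hg.continuousOn]
      have : (fun x ↦ f x * g x) = fun _ ↦ (0 : ℝ) := by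
        funext x
        rcases le_total x c with h | h
        · simp [f, h]
        · simp [g, h]
      rw [this, cfc_const_zero]
    have hne : ∀ (k : ℝ → ℝ), Continuous k → ∀ z ∈ spectrum ℝ T, k z ≠ 0 → cfc k T ≠ 0 := by
      intro k hk z hz hkz h0
      have hmem : k z ∈ spectrum ℝ (cfc k T) := by
        rw [cfc_map_spectrum k T hT hk.continuousOn]
        exact ⟨z, hz, rfl⟩
      have : Nontrivial (H →L[ℂ] H) := by
        obtain ⟨x, hx⟩ := hπ.1
        have : Nontrivial H := ⟨x, 0, hx⟩
        infer_instance
      rw [h0, spectrum.zero_eq] at hmem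
      exact hkz hmem
    have hf0 : cfc f T ≠ 0 := hne f hf m hm (by
      have : 0 < m - c := by simp only [c]; linarith
      exact (lt_max_of_lt_left this).ne')
    have hg0 : cfc g T ≠ 0 := hne g hg l hl (by
      have : 0 < c - l := by simp only [c]; linarith
      exact (lt_max_of_lt_left this).ne')
    have hfcomm : ∀ a x, cfc f T (π a x) = π a (cfc f T x) := fun a x ↦
      congrArg (fun S : H →L[ℂ] H ↦ S x) ((hcomm a).cfc_real f).eq
    rcases hπ.2 (LinearMap.ker ((cfc f T : H →L[ℂ] H) : H →ₗ[ℂ] H)) (cfc f T).isClosed_ker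
      (fun a x hx ↦ by
        have hx : cfc f T x = 0 := hx
        change cfc f T (π a x) = 0
        simp [hfcomm, hx]) with hbot | htop
    · refine hg0 (ContinuousLinearMap.ext fun x ↦ ?_)
      have : cfc g T x ∈ LinearMap.ker ((cfc f T : H →L[ℂ] H) : H →ₗ[ℂ] H) :=
        congrArg (fun S : H →L[ℂ] H ↦ S x) hfg
      rw [hbot] at this
      simpa using this
    · refine hf0 (ContinuousLinearMap.ext fun x ↦ ?_)
      have : x ∈ LinearMap.ker ((cfc f T : H →L[ℂ] H) : H →ₗ[ℂ] H) := by simp [htop]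
      exact this
  rcases hsub.eq_empty_or_singleton with he | ⟨r, hr⟩
  · refine ⟨0, ?_⟩
    rw [CFC.eq_algebraMap_of_spectrum_subset_singleton (R := ℝ) T 0 (by simp [he])]
    simp
  · refine ⟨r, ?_⟩
    rw [CFC.eq_algebraMap_of_spectrum_subset_singleton (R := ℝ) T r hr.le,
      Algebra.algebraMap_eq_smul_one]
    simp

/-- A positive functional dominated by a vector functional of an irreducible representation is a
scalar multiple of it. -/
lemma IsIrredRep.eq_smul_of_le {A : Type*} [NonUnitalCStarAlgebra A]
    {H : Type*} [NormedAddCommGroup H] [InnerProductSpace ℂ H] [CompleteSpace H]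
    {π : A →⋆ₙₐ[ℂ] (H →L[ℂ] H)} (hπ : IsIrredRep A π) (hπ0 : ∃ a, π a ≠ 0)
    {h : H} (hh : h ≠ 0) {φ ψ : A →L[ℂ] ℂ} (hφ : ∀ a, φ a = ⟪h, π a h⟫_ℂ)
    (hψ : ∀ a, 0 ≤ ψ (star a * a)) (hle : ∀ a, ψ (star a * a) ≤ φ (star a * a)) :
    ∃ r : ℝ, ψ = (r : ℂ) • φ := by
  let _ := CStarAlgebra.spectralOrder A
  have _ := CStarAlgebra.spectralOrderedRing A
  let f := positiveLinearMapOfNonneg ψ hψ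
  have hinner : ∀ a b, φ (star a * b) = ⟪π a h, π b h⟫_ℂ := fun a b ↦ by
    rw [hφ, map_mul, map_star, ContinuousLinearMap.star_eq_adjoint,
      mul_apply_eq_comp, ContinuousLinearMap.adjoint_inner_right]
  let e : A →ₗ[ℂ] H := (ContinuousLinearMap.apply ℂ H h : (H →L[ℂ] H) →ₗ[ℂ] H) ∘ₗ
    (π : A →ₗ[ℂ] (H →L[ℂ] H))
  let v : A →ₗ[ℂ] f.GNS :=
    (UniformSpace.Completion.toComplL : f.PreGNS →L[ℂ] f.GNS).toLinearMap ∘ₗ f.toPreGNS.toLinearMap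
  have hv : ∀ a b, ⟪v a, v b⟫_ℂ = ψ (star a * b) := fun a b ↦
    (UniformSpace.Completion.inner_coe _ _).trans rfl
  have hdense : DenseRange e := hπ.denseRange_apply hπ0 hh
  have hbound : ∀ a, ‖v a‖ ≤ 1 * ‖e a‖ := fun a ↦ by
    rw [one_mul, ← sq_le_sq₀ (norm_nonneg _) (norm_nonneg _), ← Complex.real_le_real]
    have h1 := inner_self_eq_norm_sq_to_K (𝕜 := ℂ) (v a)
    have h2 := inner_self_eq_norm_sq_to_K (𝕜 := ℂ) (e a)
    rw [hv] at h1
    have h3 := (hinner a a).trans h2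
    have h4 := hle a
    rw [h1, h3] at h4
    simpa using h4
  let S : H →L[ℂ] f.GNS := v.extendOfNorm e
  have hS : ∀ a, S (π a h) = v a := LinearMap.extendOfNorm_eq hdense ⟨1, hbound⟩
  let T : H →L[ℂ] H := S.adjoint ∘L S
  have hTi : ∀ x y, ⟪x, T y⟫_ℂ = ⟪S x, S y⟫_ℂ := fun x y ↦
    ContinuousLinearMap.adjoint_inner_right S x (S y)
  have hT : IsSelfAdjoint T := by
    rw [ContinuousLinearMap.isSelfAdjoint_iff']
    simp [T, ContinuousLinearMap.adjoint_comp]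
  have hcomm : ∀ c, Commute T (π c) := fun c ↦ by
    have key : ∀ x y, ⟪x, T (π c y)⟫_ℂ = ⟪x, π c (T y)⟫_ℂ := by
      intro x y
      have hr : ⟪x, π c (T y)⟫_ℂ = ⟪π (star c) x, T y⟫_ℂ := by
        rw [map_star, ContinuousLinearMap.star_eq_adjoint,
          ContinuousLinearMap.adjoint_inner_left]
      rw [hr]
      refine hdense.induction_on₂ (p := fun x y ↦ ⟪x, T (π c y)⟫_ℂ = ⟪π (star c) x, T y⟫_ℂ)
        (isClosed_eq (by fun_prop) (by fun_prop)) (fun a b ↦ ?_) x y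
      have h1 : π c (e b) = π (c * b) h := by simp [e]
      have h2 : π (star c) (e a) = π (star c * a) h := by simp [e]
      rw [hTi, hTi, h1, h2]
      change ⟪S (π a h), _⟫_ℂ = ⟪_, S (π b h)⟫_ℂ
      rw [hS, hS, hS, hS, hv, hv]
      simp [mul_assoc]
    exact ContinuousLinearMap.ext fun y ↦ ext_inner_left ℂ fun x ↦ key x y
  obtain ⟨r, hr⟩ := hπ.eq_smul_one_of_commute hT hcomm
  refine ⟨r, ContinuousLinearMap.eq_of_eq_star_mul_self fun a ↦ ?_⟩
  rw [← hv, ← hS, ← hTi, hr]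
  simp [hinner]

/-- Vector states of a nonvanishing irreducible representation are states. -/
lemma IsIrredRep.isState_of_forall_eq_inner {A : Type*} [NonUnitalCStarAlgebra A]
    {H : Type*} [NormedAddCommGroup H] [InnerProductSpace ℂ H] [CompleteSpace H]
    {π : A →⋆ₙₐ[ℂ] (H →L[ℂ] H)} (hπ : IsIrredRep A π) (hπ0 : ∃ a, π a ≠ 0)
    {h : H} (hh : ‖h‖ = 1) {φ : A →L[ℂ] ℂ} (hφ : ∀ a, φ a = ⟪h, π a h⟫_ℂ) : IsState A φ := by
  refine ⟨fun a ↦ ?_, le_antisymm ?_ ?_⟩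
  · rw [hφ, map_mul, map_star, ContinuousLinearMap.star_eq_adjoint,
      mul_apply_eq_comp, ContinuousLinearMap.adjoint_inner_right]
    rw [inner_self_eq_norm_sq_to_K]
    change (0 : ℂ) ≤ ((‖π a h‖ : ℝ) : ℂ) ^ 2
    exact_mod_cast sq_nonneg ‖π a h‖
  · refine φ.opNorm_le_bound zero_le_one fun a ↦ ?_
    rw [hφ, one_mul]
    calc ‖⟪h, π a h⟫_ℂ‖ ≤ ‖h‖ * (‖π a‖ * ‖h‖) :=
          (norm_inner_le_norm _ _).trans (by gcongr; exact (π a).le_opNorm h)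
      _ ≤ ‖a‖ := by simpa [hh] using NonUnitalStarAlgHom.norm_apply_le π a
  · let _ := CStarAlgebra.spectralOrder A
    have _ := CStarAlgebra.spectralOrderedRing A
    have hl := CStarAlgebra.increasingApproximateUnit A
    have hπc : Continuous π := AddMonoidHomClass.continuous_of_bound π 1
      (by simpa using NonUnitalStarAlgHom.norm_apply_le π)
    have hdense := hπ.denseRange_apply hπ0 (h := h) (by rintro rfl; simp at hh)
    have hconv : Filter.Tendsto (fun u ↦ π u h) (CStarAlgebra.approximateUnit A) (nhds h) := by
      rw [Metric.tendsto_nhds]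
      intro ε hε
      obtain ⟨a, ha⟩ := Metric.denseRange_iff.mp hdense h (ε / 3) (by positivity)
      have h1 : Filter.Tendsto (fun u ↦ π (u * a) h) (CStarAlgebra.approximateUnit A)
          (nhds (π a h)) :=
        ((ContinuousLinearMap.apply ℂ H h).continuous.comp hπc).continuousAt.tendsto.comp
          (hl.tendsto_mul_right a)
      filter_upwards [Metric.tendsto_nhds.mp h1 (ε / 3) (by positivity), hl.eventually_norm]
        with u hu hu1
      have h2 : dist (π u h) (π (u * a) h) ≤ dist h (π a h) := by
        rw [map_mul, mul_apply_eq_comp, dist_eq_norm, dist_eq_norm, ← map_sub]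
        refine ((π u).le_opNorm _).trans ?_
        exact mul_le_of_le_one_left (norm_nonneg _)
          ((NonUnitalStarAlgHom.norm_apply_le π u).trans hu1)
      have h3 := dist_triangle4 (π u h) (π (u * a) h) (π a h) h
      rw [dist_comm (π a h) h] at h3
      linarith
    have hlim : Filter.Tendsto (fun u ↦ ‖φ u‖) (CStarAlgebra.approximateUnit A) (nhds 1) := by
      have h1 := (tendsto_const_nhds.inner hconv (x := h) (𝕜 := ℂ)).norm
      simpa [hφ, inner_self_eq_norm_sq_to_K, hh] using h1
    refine le_of_tendsto hlim ?_
    filter_upwards [hl.eventually_norm] with u hu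
    exact (φ.le_opNorm u).trans (mul_le_of_le_one_right (norm_nonneg _) hu)

/-- Vector states of a nonvanishing irreducible representation are pure. -/
lemma IsIrredRep.isPureState_of_forall_eq_inner {A : Type*} [NonUnitalCStarAlgebra A]
    {H : Type*} [NormedAddCommGroup H] [InnerProductSpace ℂ H] [CompleteSpace H]
    {π : A →⋆ₙₐ[ℂ] (H →L[ℂ] H)} (hπ : IsIrredRep A π) (hπ0 : ∃ a, π a ≠ 0)
    {h : H} (hh : ‖h‖ = 1) {φ : A →L[ℂ] ℂ} (hφ : ∀ a, φ a = ⟪h, π a h⟫_ℂ) :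
    IsPureState A φ := by
  have hφs := hπ.isState_of_forall_eq_inner hπ0 hh hφ
  refine mem_extremePoints_iff_left.mpr ⟨hφs, ?_⟩
  rintro φ₁ hφ₁ φ₂ hφ₂ ⟨s, t, hs, ht, hst, hsum⟩
  have hdom : ∀ a, ((s : ℂ) • φ₁) (star a * a) ≤ φ (star a * a) := fun a ↦ by
    have ht' : (0 : ℂ) ≤ t := by exact_mod_cast ht.le
    rw [← hsum]
    simpa using mul_nonneg ht' (hφ₂.1 a)
  obtain ⟨r, hr⟩ := hπ.eq_smul_of_le hπ0 (h := h) (by rintro rfl; simp at hh) hφ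
    (ψ := (s : ℂ) • φ₁) (fun a ↦ by
      have hs' : (0 : ℂ) ≤ s := by exact_mod_cast hs.le
      simpa using mul_nonneg hs' (hφ₁.1 a)) hdom
  have hu : ∃ a, φ (star a * a) ≠ 0 := by
    by_contra! hcon
    have : φ = 0 := ContinuousLinearMap.eq_of_eq_star_mul_self (by simpa using hcon)
    have h1 := hφs.2
    simp [this] at h1
  have hr0 : 0 ≤ r := by
    obtain ⟨a, ha⟩ := hu
    have h1 : (0 : ℂ) ≤ r * φ (star a * a) := by
      have h2 := congrArg (fun θ : A →L[ℂ] ℂ ↦ θ (star a * a)) hr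
      simp only [smul_apply, smul_eq_mul] at h2
      rw [← h2]
      exact mul_nonneg (by exact_mod_cast hs.le) (hφ₁.1 a)
    have hpos := lt_of_le_of_ne (hφs.1 a) ha.symm
    have h3 : 0 ≤ r * (φ (star a * a)).re := by simpa using h1.1
    exact nonneg_of_mul_nonneg_left h3 hpos.1
  have hrs : s = r := by
    have h1 := congrArg norm hr
    rw [norm_smul, norm_smul, hφ₁.2, hφs.2] at h1
    simpa [abs_of_pos hs, abs_of_nonneg hr0] using h1
  subst hrs
  exact smul_right_injective _ (by exact_mod_cast hs.ne' : (s : ℂ) ≠ 0) hr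

/-- Compressing by elements of a hereditary subalgebra lands in the subalgebra. -/
lemma IsHereditary.mul_mul_mem {A : Type*} [NonUnitalCStarAlgebra A] [PartialOrder A]
    [StarOrderedRing A] {B : NonUnitalStarSubalgebra ℂ A} (hB : IsHereditary A B)
    {b c : A} (hb : b ∈ B) (hc : c ∈ B) (a : A) : b * a * c ∈ B := by
  have hconj : ∀ d ∈ B, ∀ a : A, star d * a * d ∈ B := by
    intro d hd a
    have ha : a ∈ Submodule.span ℂ {a : A | 0 ≤ a} := by simp [CStarAlgebra.span_nonneg]
    induction ha using Submodule.span_induction with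
    | mem a ha =>
      have ha : 0 ≤ a := ha
      refine hB.2 _ (‖a‖ • (star d * d)) ?_ (star_left_conjugate_nonneg ha d)
        (CStarAlgebra.star_left_conjugate_le_norm_smul)
      rw [← Complex.coe_smul]
      exact SMulMemClass.smul_mem _ (mul_mem (star_mem hd) hd)
    | zero => simp
    | add x y _ _ hx hy =>
      rw [mul_add, add_mul]
      exact add_mem hx hy
    | smul z x _ hx =>
      rw [mul_smul_comm, smul_mul_assoc]
      exact SMulMemClass.smul_mem z hx
  have hb' := star_mem hb
  have h0 : star (star b) * a * star b + star c * a * c ∈ B :=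
    add_mem (hconj _ hb' a) (hconj c hc a)
  have h1 := sub_mem (hconj _ (add_mem hb' hc) a) h0
  have h2 := sub_mem (hconj _ (add_mem hb' (SMulMemClass.smul_mem Complex.I hc)) a) h0
  have h3 := SMulMemClass.smul_mem (2⁻¹ : ℂ) (sub_mem h1 (SMulMemClass.smul_mem Complex.I h2))
  convert h3 using 1
  simp only [star_add, star_star, star_smul, add_mul, mul_add, smul_mul_assoc, mul_smul_comm,
    smul_add, smul_sub, smul_smul, Complex.star_def, Complex.conj_I]
  simp only [mul_neg, Complex.I_mul_I, mul_one, neg_neg, neg_smul]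
  module

/-- The restriction of a representation to a closed invariant subspace. -/
def restrictRep {A : Type*} [NonUnitalNormedRing A] [NormedSpace ℂ A] [StarRing A]
    {H : Type*} [NormedAddCommGroup H] [InnerProductSpace ℂ H] [CompleteSpace H]
    (π : A →⋆ₙₐ[ℂ] (H →L[ℂ] H)) (K : Submodule ℂ H) [CompleteSpace K]
    (hK : ∀ a, ∀ x ∈ K, π a x ∈ K) : A →⋆ₙₐ[ℂ] (K →L[ℂ] K) where
  toFun a := ((π a).comp K.subtypeL).codRestrict K fun x ↦ hK a x x.2
  map_smul' c a := by
    ext x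
    change π _ (x : H) = _
    simp
    rfl
  map_zero' := by ext x; simp
  map_add' a b := by
    ext x
    change π _ (x : H) = _
    simp
    rfl
  map_mul' a b := by
    ext x
    change π _ (x : H) = _
    simp
    rfl
  map_star' a := by
    rw [ContinuousLinearMap.star_eq_adjoint, ContinuousLinearMap.eq_adjoint_iff]
    intro x y
    change ⟪π (star a) x, (y : H)⟫_ℂ = ⟪(x : H), π a y⟫_ℂ
    rw [map_star, ContinuousLinearMap.star_eq_adjoint, ContinuousLinearMap.adjoint_inner_left]

lemma apply_mem_repSpan {A : Type*} [NonUnitalNormedRing A] [NormedSpace ℂ A] [StarRing A]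
    {H : Type*} [NormedAddCommGroup H] [InnerProductSpace ℂ H] [CompleteSpace H]
    (π : A →⋆ₙₐ[ℂ] (H →L[ℂ] H)) {S : Set A} {b : A} (hb : b ∈ S) (x : H) :
    π b x ∈ repSpan A π S :=
  Submodule.le_topologicalClosure _ (Submodule.subset_span ⟨b, hb, x, rfl⟩)

/-- The orthogonal complement of `K_π(B)` is the common kernel of `π(B)`. -/
lemma mem_orthogonal_repSpan_iff {A : Type*} [NonUnitalNormedRing A] [NormedSpace ℂ A]
    [StarRing A] {H : Type*} [NormedAddCommGroup H] [InnerProductSpace ℂ H] [CompleteSpace H]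
    (π : A →⋆ₙₐ[ℂ] (H →L[ℂ] H)) (B : NonUnitalStarSubalgebra ℂ A) (y : H) :
    y ∈ (repSpan A π (B : Set A))ᗮ ↔ ∀ b ∈ B, π b y = 0 := by
  have hadj : ∀ (b : A) (x : H), ⟪π b x, y⟫_ℂ = ⟪x, π (star b) y⟫_ℂ := fun b x ↦ by
    rw [map_star, ContinuousLinearMap.star_eq_adjoint, ContinuousLinearMap.adjoint_inner_right]
  constructor
  · intro hy b hb
    refine ext_inner_left ℂ fun x ↦ ?_
    have h := (Submodule.mem_orthogonal _ y).1 hy _ (apply_mem_repSpan π (star_mem hb) x)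
    rw [hadj, star_star] at h
    rw [h, inner_zero_right]
  · intro hy
    rw [repSpan, Submodule.orthogonal_closure, Submodule.mem_orthogonal]
    intro u hu
    induction hu using Submodule.span_induction with
    | mem u hu =>
      obtain ⟨b, hb, x, rfl⟩ := hu
      rw [hadj, hy _ (star_mem hb), inner_zero_right]
    | zero => simp
    | add u v _ _ hu hv => rw [inner_add_left, hu, hv, add_zero]
    | smul c u _ hu => rw [inner_smul_left, hu, mul_zero]

/-- An irreducible representation that does not vanish on a hereditary subalgebra `B` restricts
to an irreducible representation of `B` on `K_π(B)`. -/
lemma IsIrredRep.restrict_hereditary {A : Type*} [NonUnitalCStarAlgebra A] [PartialOrder A]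
    [StarOrderedRing A] {B : NonUnitalStarSubalgebra ℂ A} (hB : IsHereditary A B)
    {H : Type*} [NormedAddCommGroup H] [InnerProductSpace ℂ H] [CompleteSpace H]
    {π : A →⋆ₙₐ[ℂ] (H →L[ℂ] H)} (hπ : IsIrredRep A π) (hπB : ∃ b ∈ B, π b ≠ 0)
    [CompleteSpace (repSpan A π (B : Set A))]
    (hinv : ∀ (b : B), ∀ x ∈ repSpan A π (B : Set A),
      (π.comp (NonUnitalStarSubalgebraClass.subtype B)) b x ∈ repSpan A π (B : Set A)) :
    IsIrredRep B (restrictRep (π.comp (NonUnitalStarSubalgebraClass.subtype B)) _ hinv) := by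
  obtain ⟨b₀, hb₀, hπb₀⟩ := hπB
  refine ⟨?_, fun L hL hLinv ↦ or_iff_not_imp_left.mpr fun hLne ↦ ?_⟩
  · obtain ⟨x, hx⟩ : ∃ x, π b₀ x ≠ 0 := by
      by_contra! hcon
      exact hπb₀ (ContinuousLinearMap.ext hcon)
    exact ⟨⟨π b₀ x, apply_mem_repSpan π hb₀ x⟩, fun h ↦ hx (congrArg Subtype.val h)⟩
  obtain ⟨ξ, hξL, hξ⟩ := (Submodule.ne_bot_iff L).1 hLne
  obtain ⟨c, hc, hcξ⟩ : ∃ c ∈ B, π c (ξ : H) ≠ 0 := by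
    by_contra! hcon
    have h := (mem_orthogonal_repSpan_iff π B ξ).2 hcon
    exact hξ (Subtype.ext (Submodule.disjoint_def.1
      (Submodule.orthogonal_disjoint (repSpan A π (B : Set A))) _ ξ.2 h))
  have hdense := hπ.denseRange_apply ⟨b₀, hπb₀⟩ hcξ
  have hLclosed : IsClosed ((L.map (repSpan A π (B : Set A)).subtype : Submodule ℂ H) : Set H) := by
    have : IsClosed ((repSpan A π (B : Set A) : Submodule ℂ H) : Set H) :=
      Submodule.isClosed_topologicalClosure _
    exact this.isClosedEmbedding_subtypeVal.isClosedMap _ hL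
  have hmem : ∀ b ∈ B, ∀ x : H, π b x ∈ L.map (repSpan A π (B : Set A)).subtype := by
    intro b hb x
    refine hdense.induction_on (p := fun x ↦ π b x ∈ L.map (repSpan A π (B : Set A)).subtype) x
      (hLclosed.preimage (π b).continuous) fun a ↦ ?_
    refine ⟨_, hLinv ⟨b * a * c, hB.mul_mul_mem hb hc a⟩ ξ hξL, ?_⟩
    change π (b * a * c) (ξ : H) = _
    simp
  have hle : repSpan A π (B : Set A) ≤ L.map (repSpan A π (B : Set A)).subtype := by
    refine Submodule.topologicalClosure_minimal _ (Submodule.span_le.2 ?_) hLclosed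
    rintro _ ⟨b, hb, x, rfl⟩
    exact hmem b hb x
  refine eq_top_iff.2 fun x _ ↦ ?_
  obtain ⟨y, hy, hyx⟩ := hle x.2
  rwa [← Subtype.ext hyx]

/-- The continuous linear functional `a ↦ ⟪h, π a h⟫`. -/
lemma exists_vectorFunctional {A : Type*} [NonUnitalCStarAlgebra A]
    {H : Type*} [NormedAddCommGroup H] [InnerProductSpace ℂ H] [CompleteSpace H]
    (π : A →⋆ₙₐ[ℂ] (H →L[ℂ] H)) (h : H) :
    ∃ φ : A →L[ℂ] ℂ, ∀ a, φ a = ⟪h, π a h⟫_ℂ := by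
  have hπc : Continuous π := AddMonoidHomClass.continuous_of_bound π 1
    (by simpa using NonUnitalStarAlgHom.norm_apply_le π)
  exact ⟨(innerSL ℂ h ∘L ContinuousLinearMap.apply ℂ H h) ∘L ⟨(π : A →ₗ[ℂ] (H →L[ℂ] H)), hπc⟩,
    fun a ↦ rfl⟩

/-- If `π` is an irreducible representation of `A` with `π(B) ≠ 0` and
`K_π(B) ⊊ H`, then every scaled pure state `t·(b ↦ ⟪x, π b x⟫)` of `B`
(with `t ∈ (0,1]`, `x` a unit vector of `K_π(B)`) arises as the restriction
of a vector state of `A`. -/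
theorem scaled_restriction_is_attained
    {A : Type*} [NonUnitalNormedRing A] [NormedSpace ℂ A] [StarRing A]
    [CStarRing A] [CompleteSpace A] [IsScalarTower ℂ A A] [SMulCommClass ℂ A A]
    [StarModule ℂ A] [PartialOrder A] [StarOrderedRing A]
    (B : NonUnitalStarSubalgebra ℂ A) (hB : IsHereditary A B)
    (hBne : ∃ b ∈ B, b ≠ (0 : A))
    {H : Type*} [NormedAddCommGroup H] [InnerProductSpace ℂ H] [CompleteSpace H]
    (π : A →⋆ₙₐ[ℂ] (H →L[ℂ] H)) (hπ : IsIrredRep A π)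
    (hπB : ∃ b ∈ B, π b ≠ 0)
    (hK : repSpan A π (B : Set A) ≠ ⊤) :
    ∀ t : ℝ, 0 < t → t ≤ 1 →
      ∀ x : H, x ∈ repSpan A π (B : Set A) → ‖x‖ = 1 →
        ∃ h : H, ‖h‖ = 1 ∧
          (∀ b ∈ B, ⟪h, π b h⟫_ℂ = (t : ℂ) * ⟪x, π b x⟫_ℂ) ∧
          -- in particular: the vector state of `A` given by `h` is a pure state of `A`…
          (∃ φ : A →L[ℂ] ℂ, IsPureState A φ ∧ ∀ a : A, φ a = ⟪h, π a h⟫_ℂ) ∧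
          -- …whose restriction to `B` is `t` times the pure state `b ↦ ⟪x, π b x⟫` of `B`
          (∃ τ : ↥B →L[ℂ] ℂ, IsPureState ↥B τ ∧
            (∀ b : ↥B, τ b = ⟪x, π (b : A) x⟫_ℂ) ∧
            ∀ b : ↥B, ⟪h, π (b : A) h⟫_ℂ = (t : ℂ) * τ b) := by
  intro t ht ht1 x hx hxn
  let _ : NonUnitalCStarAlgebra A := { }
  have : IsClosed (B : Set A) := hB.1
  have : CompleteSpace (repSpan A π (B : Set A)) :=
    (Submodule.isClosed_topologicalClosure _).completeSpace_coe
  obtain ⟨b₀, hb₀, hπb₀⟩ := hπB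
  obtain ⟨y, hyK, hyn⟩ : ∃ y ∈ (repSpan A π (B : Set A))ᗮ, ‖y‖ = 1 := by
    obtain ⟨z, hz, hz0⟩ := (Submodule.ne_bot_iff _).1
      (mt (Submodule.orthogonal_eq_bot_iff (K := repSpan A π (B : Set A))).1 hK)
    exact ⟨((‖z‖⁻¹ : ℝ) : ℂ) • z, Submodule.smul_mem _ _ hz, by simp [norm_smul, hz0]⟩
  have hy0 := (mem_orthogonal_repSpan_iff π B y).1 hyK
  have hperp : ∀ z ∈ repSpan A π (B : Set A), ⟪y, z⟫_ℂ = 0 := fun z hz ↦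
    Submodule.inner_left_of_mem_orthogonal hz hyK
  let h : H := (√t : ℂ) • x + (√(1 - t) : ℂ) • y
  have hst : (√t : ℂ) * √t = t := by exact_mod_cast Real.mul_self_sqrt ht.le
  have hhn : ‖h‖ = 1 := by
    have hxy : ⟪(√t : ℂ) • x, (√(1 - t) : ℂ) • y⟫_ℂ = 0 := by
      rw [inner_smul_left, inner_smul_right,
        Submodule.inner_right_of_mem_orthogonal hx hyK, mul_zero, mul_zero]
    have hsq := norm_add_sq_eq_norm_sq_add_norm_sq_of_inner_eq_zero _ _ hxy
    rw [norm_smul, norm_smul, hxn, hyn, mul_one, mul_one, Complex.norm_real, Complex.norm_real,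
      Real.norm_of_nonneg (Real.sqrt_nonneg _), Real.norm_of_nonneg (Real.sqrt_nonneg _),
      Real.mul_self_sqrt ht.le, Real.mul_self_sqrt (by linarith)] at hsq
    nlinarith [norm_nonneg h]
  have hhB : ∀ b ∈ B, ⟪h, π b h⟫_ℂ = (t : ℂ) * ⟪x, π b x⟫_ℂ := by
    intro b hb
    have h1 : π b h = (√t : ℂ) • π b x := by simp [h, hy0 b hb]
    rw [h1, inner_add_left, inner_smul_left, inner_smul_left, inner_smul_right, inner_smul_right,
      hperp _ (apply_mem_repSpan π hb x), Complex.conj_ofReal, ← mul_assoc, hst]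
    simp
  refine ⟨h, hhn, hhB, ?_, ?_⟩
  · obtain ⟨φ, hφ⟩ := exists_vectorFunctional π h
    exact ⟨φ, hπ.isPureState_of_forall_eq_inner ⟨b₀, hπb₀⟩ hhn hφ, hφ⟩
  · have hinv : ∀ (b : B), ∀ x ∈ repSpan A π (B : Set A),
        (π.comp (NonUnitalStarSubalgebraClass.subtype B)) b x ∈ repSpan A π (B : Set A) :=
      fun b x _ ↦ apply_mem_repSpan π b.2 x
    have hσ := hπ.restrict_hereditary hB ⟨b₀, hb₀, hπb₀⟩ hinv
    have hx0 : ∃ b : B, restrictRep (π.comp (NonUnitalStarSubalgebraClass.subtype B)) _ hinv b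
        ≠ 0 := by
      by_contra! hcon
      have hxK : x ∈ (repSpan A π (B : Set A))ᗮ :=
        (mem_orthogonal_repSpan_iff π B x).2 fun b hb ↦ by
          have h1 := congrArg (fun S ↦ ((S ⟨x, hx⟩ : repSpan A π (B : Set A)) : H)) (hcon ⟨b, hb⟩)
          exact h1
      have h0 : x = 0 := Submodule.disjoint_def.1
        (Submodule.orthogonal_disjoint (repSpan A π (B : Set A))) _ hx hxK
      simp [h0] at hxn
    obtain ⟨τ, hτ⟩ := exists_vectorFunctional
      (restrictRep (π.comp (NonUnitalStarSubalgebraClass.subtype B)) _ hinv) ⟨x, hx⟩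
    have hτ' : ∀ b : B, τ b = ⟪x, π (b : A) x⟫_ℂ := hτ
    exact ⟨τ, hσ.isPureState_of_forall_eq_inner hx0 (h := ⟨x, hx⟩) hxn hτ, hτ',
      fun b ↦ by rw [hhB b b.2, hτ']⟩
end
end

section
/- Let A be a C*-algebra and let B be a nonzero hereditary C*-subalgebra of A. Then B is a closed two-sided ideal of A if and only if for every irreducible representation π of A on a Hilbert space H with π(B) ≠ {0}, the closed linear span K_π(B) of {π(b)x : b ∈ B, x ∈ H} equals H. -/
open scoped ComplexOrder InnerProductSpace

noncomputable section

variable (A : Type*) [NonUnitalNormedRing A] [NormedSpace ℂ A] [StarRing A]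

variable {H : Type*} [NormedAddCommGroup H] [InnerProductSpace ℂ H] [CompleteSpace H]

universe u

section Unital

variable {U : Type*} [CStarAlgebra U] [PartialOrder U] [StarOrderedRing U]

/-- The states of a unital C*-algebra that vanish on `T`, as a subset of the space of all
functions. -/
def statesVanishingOn (T : Set U) : Set (U → ℂ) :=
  {f | (∀ x y, f (x + y) = f x + f y) ∧ (∀ (c : ℂ) x, f (c • x) = c * f x) ∧
    (∀ x, 0 ≤ x → 0 ≤ f x) ∧ f 1 = 1 ∧ ∀ b ∈ T, f b = 0}

/-- A state, given as a function, as a positive linear map. -/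
def statesVanishingOn.toPositiveLinearMap {T : Set U} {f : U → ℂ}
    (hf : f ∈ statesVanishingOn T) : U →ₚ[ℂ] ℂ :=
  PositiveLinearMap.mk₀
    { toFun := f
      map_add' := hf.1
      map_smul' := by intro c x; simpa using hf.2.1 c x } hf.2.2.1

lemma PositiveLinearMap.norm_apply_le_of_isSelfAdjoint (φ : U →ₚ[ℂ] ℂ) (h1 : φ 1 = 1)
    {h : U} (hh : IsSelfAdjoint h) : ‖φ h‖ ≤ ‖h‖ := by
  have hn : φ (algebraMap ℝ U ‖h‖) = (‖h‖ : ℂ) := by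
    rw [Algebra.algebraMap_eq_smul_one, ← Complex.coe_smul, map_smul, h1]; simp
  have h2 := φ.apply_le_of_isSelfAdjoint h hh
  have h3 := φ.apply_le_of_isSelfAdjoint (-h) hh.neg
  rw [norm_neg, map_neg, hn] at h3
  rw [hn] at h2
  rw [Complex.le_def] at h2 h3
  simp only [Complex.ofReal_re, Complex.ofReal_im, Complex.neg_re, Complex.neg_im] at h2 h3
  have : φ h = ((φ h).re : ℂ) := Complex.ext (by simp) (by simp [h2.2])
  rw [this, Complex.norm_real, Real.norm_eq_abs, abs_le]
  constructor <;> linarith [h2.1, h3.1]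

lemma PositiveLinearMap.norm_apply_le_two_mul (φ : U →ₚ[ℂ] ℂ) (h1 : φ 1 = 1) (x : U) :
    ‖φ x‖ ≤ 2 * ‖x‖ := by
  have hx := realPart_add_I_smul_imaginaryPart x
  calc ‖φ x‖ = ‖φ (realPart x : U) + Complex.I * φ (imaginaryPart x : U)‖ := by
        conv_lhs => rw [← hx, map_add, map_smul, smul_eq_mul]
    _ ≤ ‖φ (realPart x : U)‖ + ‖φ (imaginaryPart x : U)‖ := by
        refine (norm_add_le _ _).trans_eq ?_
        simp
    _ ≤ ‖x‖ + ‖x‖ := by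
        gcongr
        · exact (φ.norm_apply_le_of_isSelfAdjoint h1 (realPart x).2).trans (realPart.norm_le x)
        · exact (φ.norm_apply_le_of_isSelfAdjoint h1 (imaginaryPart x).2).trans
            (imaginaryPart.norm_le x)
    _ = 2 * ‖x‖ := by ring

lemma isCompact_statesVanishingOn (T : Set U) : IsCompact (statesVanishingOn T) := by
  have hK : IsCompact (Set.univ.pi fun x : U ↦ Metric.closedBall (0 : ℂ) (2 * ‖x‖)) :=
    isCompact_univ_pi fun x ↦ isCompact_closedBall _ _
  refine hK.of_isClosed_subset ?_ ?_
  · simp only [statesVanishingOn, Set.ofPred_and, Set.ofPred_forall]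
    refine .inter ?_ (.inter ?_ (.inter ?_ (.inter ?_ ?_)))
    · exact isClosed_iInter fun x ↦ isClosed_iInter fun y ↦
        isClosed_eq (by fun_prop) (by fun_prop)
    · exact isClosed_iInter fun x ↦ isClosed_iInter fun y ↦
        isClosed_eq (by fun_prop) (by fun_prop)
    · exact isClosed_iInter fun x ↦ isClosed_iInter fun y ↦
        isClosed_le (by fun_prop) (by fun_prop)
    · exact isClosed_eq (by fun_prop) (by fun_prop)
    · exact isClosed_iInter fun x ↦ isClosed_iInter fun y ↦
        isClosed_eq (by fun_prop) (by fun_prop)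
  · intro f hf x _
    rw [mem_closedBall_zero_iff]
    exact (statesVanishingOn.toPositiveLinearMap hf).norm_apply_le_two_mul hf.2.2.2.1 x

omit [StarOrderedRing U] in
lemma convex_statesVanishingOn (T : Set U) : Convex ℝ (statesVanishingOn T) := by
  rintro f ⟨f1, f2, f3, f4, f5⟩ g ⟨g1, g2, g3, g4, g5⟩ s t hs ht hst
  refine ⟨fun x y ↦ ?_, fun c x ↦ ?_, fun x hx ↦ ?_, ?_, fun b hb ↦ ?_⟩
  · simp only [Pi.add_apply, Pi.smul_apply, f1, g1, smul_add]; abel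
  · simp only [Pi.add_apply, Pi.smul_apply, f2, g2, Complex.real_smul]; ring
  · have hf := f3 x hx
    have hg := g3 x hx
    simp only [Pi.add_apply, Pi.smul_apply]
    positivity
  · simp only [Pi.add_apply, Pi.smul_apply, f4, g4, ← add_smul, hst, one_smul]
  · simp [f5 b hb, g5 b hb]

lemma exists_extremePoint_apply_ne_zero {T : Set U} {a : U} {f : U → ℂ}
    (hf : f ∈ statesVanishingOn T) (hfa : f a ≠ 0) :
    ∃ g ∈ Set.extremePoints ℝ (statesVanishingOn T), g a ≠ 0 := by
  by_contra! h
  have hsub : closure (convexHull ℝ ((statesVanishingOn T).extremePoints ℝ)) ⊆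
      {g : U → ℂ | g a = 0} := by
    refine closure_minimal (convexHull_min (fun g hg ↦ h g hg) ?_)
      (isClosed_eq (by fun_prop) (by fun_prop))
    intro g hg k hk s t _ _ _
    simp_all
  rw [closure_convexHull_extremePoints (isCompact_statesVanishingOn T)
    (convex_statesVanishingOn T)] at hsub
  exact hfa (hsub hf)

end Unital

section Vector

variable {U : Type*} [CStarAlgebra U] [PartialOrder U] [StarOrderedRing U]
  {H : Type*} [NormedAddCommGroup H] [InnerProductSpace ℂ H] [CompleteSpace H]

lemma inner_rep_self_nonneg (π : U →⋆ₙₐ[ℂ] (H →L[ℂ] H)) (v : H) {x : U} (hx : 0 ≤ x) :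
    0 ≤ ⟪v, π x v⟫_ℂ := by
  obtain ⟨y, rfl⟩ := CStarAlgebra.nonneg_iff_eq_star_mul_self.mp hx
  rw [map_mul, map_star, ContinuousLinearMap.star_eq_adjoint, mul_apply_eq_comp,
    ContinuousLinearMap.adjoint_inner_right, inner_self_eq_norm_sq_to_K]
  positivity

lemma smul_inner_rep_self_mem_statesVanishingOn {T : Set U}
    (π : U →⋆ₙₐ[ℂ] (H →L[ℂ] H)) (hπ : π 1 = 1) {v : H} (hv : v ≠ 0)
    (hT : ∀ b ∈ T, ⟪v, π b v⟫_ℂ = 0) :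
    ((‖v‖ ^ 2)⁻¹ • fun x ↦ ⟪v, π x v⟫_ℂ) ∈ statesVanishingOn T := by
  refine ⟨fun x y ↦ ?_, fun c x ↦ ?_, fun x hx ↦ ?_, ?_, fun b hb ↦ ?_⟩
  · simp
  · simp; ring
  · have := inner_rep_self_nonneg π v hx
    simp only [Pi.smul_apply]
    positivity
  · have : (‖v‖ : ℂ) ≠ 0 := by simpa using hv
    simp [hπ, inner_self_eq_norm_sq_to_K]
    field_simp
  · simp [hT b hb]

/-- A cyclic representation whose vector state is extremal is irreducible. -/
lemma isIrredRep_of_mem_extremePoints {T : Set U} (hTpos : ∀ b ∈ T, 0 ≤ b)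
    (π : U →⋆ₙₐ[ℂ] (H →L[ℂ] H)) (hπ : π 1 = 1) (ξ : H) (hcyc : DenseRange fun x ↦ π x ξ)
    (hext : (fun x ↦ ⟪ξ, π x ξ⟫_ℂ) ∈ Set.extremePoints ℝ (statesVanishingOn T)) :
    IsIrredRep U π := by
  obtain ⟨⟨-, -, -, hone, hvan⟩, hext⟩ := hext
  have hξ : ‖ξ‖ ^ 2 = 1 := by
    have : ((‖ξ‖ ^ 2 : ℝ) : ℂ) = 1 := by
      simpa [hπ, inner_self_eq_norm_sq_to_K] using hone
    exact_mod_cast this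
  refine ⟨⟨ξ, by rintro rfl; simp at hξ⟩, fun K hK hinv ↦ ?_⟩
  have htop : ∀ L : Submodule ℂ H, IsClosed (L : Set H) → (∀ a, ∀ x ∈ L, π a x ∈ L) →
      ξ ∈ L → L = ⊤ := by
    intro L hL hLinv hξL
    rw [eq_top_iff]
    intro x _
    exact closure_minimal (Set.range_subset_iff.2 fun a ↦ hLinv a ξ hξL) hL (hcyc x)
  have hinv' : ∀ a, ∀ x ∈ Kᗮ, π a x ∈ Kᗮ := by
    intro a x hx y hy
    rw [← ContinuousLinearMap.adjoint_inner_left, ← ContinuousLinearMap.star_eq_adjoint,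
      ← map_star]
    exact hx _ (hinv _ _ hy)
  have : CompleteSpace K := hK.completeSpace_coe
  set v := K.starProjection ξ with hv
  set w := ξ - v with hw
  have hvK : v ∈ K := K.starProjection_apply_mem ξ
  have hwK : w ∈ Kᗮ := K.sub_starProjection_mem_orthogonal ξ
  have hξvw : ξ = v + w := by simp [hw]
  have hvw : ∀ x, ⟪v, π x w⟫_ℂ = 0 := fun x ↦ hinv' x w hwK v hvK
  have hwv : ∀ x, ⟪w, π x v⟫_ℂ = 0 := fun x ↦ by
    rw [← inner_conj_symm, hwK _ (hinv x v hvK), map_zero]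
  have hsplit : ∀ x, ⟪ξ, π x ξ⟫_ℂ = ⟪v, π x v⟫_ℂ + ⟪w, π x w⟫_ℂ := by
    intro x
    rw [hξvw, map_add, inner_add_left, inner_add_right, inner_add_right, hvw, hwv]
    ring
  by_cases hv0 : v = 0
  · left
    have := htop Kᗮ K.isClosed_orthogonal hinv' (by rw [hξvw, hv0, zero_add]; exact hwK)
    rwa [Submodule.orthogonal_eq_top_iff] at this
  right
  suffices hξK : ξ ∈ K from htop K hK hinv hξK
  by_cases hw0 : w = 0
  · rw [hξvw, hw0, add_zero]; exact hvK
  have hT0 : ∀ b ∈ T, ⟪v, π b v⟫_ℂ = 0 ∧ ⟪w, π b w⟫_ℂ = 0 := by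
    intro b hb
    have h0 := hsplit b
    rw [show ⟪ξ, π b ξ⟫_ℂ = 0 from hvan b hb] at h0
    exact (add_eq_zero_iff_of_nonneg (inner_rep_self_nonneg π v (hTpos b hb))
      (inner_rep_self_nonneg π w (hTpos b hb))).mp h0.symm
  have hsum : ‖v‖ ^ 2 + ‖w‖ ^ 2 = 1 := by
    have h0 := hsplit 1
    simp only [hπ, one_apply_eq_self, inner_self_eq_norm_sq_to_K] at h0
    rw [← hξ]
    exact_mod_cast h0.symm
  have hvpos : 0 < ‖v‖ ^ 2 := by positivity
  have hwpos : 0 < ‖w‖ ^ 2 := by positivity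
  have key := hext
    (smul_inner_rep_self_mem_statesVanishingOn π hπ hv0 fun b hb ↦ (hT0 b hb).1)
    (smul_inner_rep_self_mem_statesVanishingOn π hπ hw0 fun b hb ↦ (hT0 b hb).2)
    ⟨‖v‖ ^ 2, ‖w‖ ^ 2, hvpos, hwpos, hsum, by
      rw [smul_smul, smul_smul, mul_inv_cancel₀ hvpos.ne', mul_inv_cancel₀ hwpos.ne', one_smul,
        one_smul]
      funext x
      exact (hsplit x).symm⟩
  have hzero : v - ((‖v‖ ^ 2 : ℝ) : ℂ) • ξ = 0 := by
    refine hcyc.eq_zero_of_inner_left ℂ fun x ↦ ?_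
    have hx : (‖v‖ ^ 2)⁻¹ • ⟪v, π x v⟫_ℂ = ⟪ξ, π x ξ⟫_ℂ := congrFun key x
    rw [inner_sub_left, inner_smul_left, ← hx, Complex.conj_ofReal, Complex.real_smul,
      ← mul_assoc, ← Complex.ofReal_mul, mul_inv_cancel₀ hvpos.ne', Complex.ofReal_one, one_mul,
      sub_eq_zero, ← sub_eq_zero, ← inner_sub_right, ← map_sub]
    exact hvw x
  rw [sub_eq_zero] at hzero
  refine (K.smul_mem_iff (s := ((‖v‖ ^ 2 : ℝ) : ℂ)) (by exact_mod_cast hvpos.ne')).mp ?_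
  rw [← hzero]
  exact hvK

end Vector

section Representation

/-- A state of a unital C*-algebra vanishing on a set `T` of positive elements but not at `a`
gives rise to an irreducible representation with a vector state of the same kind. -/
lemma exists_isIrredRep_of_statesVanishingOn {U : Type u} [CStarAlgebra U] [PartialOrder U]
    [StarOrderedRing U] {T : Set U} (hTpos : ∀ b ∈ T, 0 ≤ b) {a : U} {f : U → ℂ}
    (hf : f ∈ statesVanishingOn T) (hfa : f a ≠ 0) :
    ∃ (H : Type u) (_ : NormedAddCommGroup H) (_ : InnerProductSpace ℂ H) (_ : CompleteSpace H)
      (π : U →⋆ₙₐ[ℂ] (H →L[ℂ] H)) (ξ : H), IsIrredRep U π ∧ π 1 = 1 ∧ ⟪ξ, π a ξ⟫_ℂ ≠ 0 ∧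
        ∀ b ∈ T, ⟪ξ, π b ξ⟫_ℂ = 0 := by
  obtain ⟨g, hg, hga⟩ := exists_extremePoint_apply_ne_zero hf hfa
  let φ := statesVanishingOn.toPositiveLinearMap hg.1
  have hφ : ∀ x, ⟪(φ.toPreGNS 1 : φ.GNS), φ.gnsNonUnitalStarAlgHom x (φ.toPreGNS 1)⟫_ℂ = g x := by
    intro x
    rw [PositiveLinearMap.gnsNonUnitalStarAlgHom_apply_coe, UniformSpace.Completion.inner_coe,
      PositiveLinearMap.preGNS_inner_def]
    simp
    rfl
  have h1 : φ.gnsNonUnitalStarAlgHom 1 = 1 := map_one φ.gnsStarAlgHom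
  refine ⟨φ.GNS, inferInstance, inferInstance, inferInstance, φ.gnsNonUnitalStarAlgHom,
    φ.toPreGNS 1, ?_, h1, ?_, ?_⟩
  · refine isIrredRep_of_mem_extremePoints hTpos _ h1 (φ.toPreGNS 1 : φ.GNS) ?_
      (by simpa only [hφ] using hg)
    have hcoe : (fun x ↦ φ.gnsNonUnitalStarAlgHom x (φ.toPreGNS 1 : φ.GNS)) =
        ((↑) : φ.PreGNS → φ.GNS) ∘ φ.toPreGNS := by
      funext x
      simp
    rw [hcoe, DenseRange, φ.toPreGNS.surjective.range_comp]
    exact UniformSpace.Completion.denseRange_coe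
  · rwa [hφ]
  · intro b hb
    rw [hφ]
    exact hg.1.2.2.2.2 b hb

end Representation

section Separation

variable {U : Type*} [CStarAlgebra U] [PartialOrder U] [StarOrderedRing U]

lemma exists_mem_statesVanishingOn_apply_ne_zero {T : Set U} (hT0 : (0 : U) ∈ T)
    (hTadd : ∀ b ∈ T, ∀ c ∈ T, b + c ∈ T) (hTsmul : ∀ r : ℝ, 0 ≤ r → ∀ b ∈ T, r • b ∈ T)
    (hTpos : ∀ b ∈ T, 0 ≤ b) {a : U} (ha : 0 ≤ a) {ε : ℝ} (hε : 0 < ε)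
    (hab : ∀ b ∈ T, ¬ a ≤ b + algebraMap ℝ U ε) :
    ∃ f ∈ statesVanishingOn T, f a ≠ 0 := by
  set C : Set U := {x | ∃ b ∈ T, (realPart x : U) ≤ b} with hC
  have hCsmul : ∀ r : ℝ, 0 ≤ r → ∀ x ∈ C, r • x ∈ C := by
    rintro r hr x ⟨b, hb, hxb⟩
    refine ⟨r • b, hTsmul r hr b hb, ?_⟩
    rw [map_smul, selfAdjoint.val_smul]
    exact smul_le_smul_of_nonneg_left hxb hr
  have hCadd : ∀ x ∈ C, ∀ y ∈ C, x + y ∈ C := by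
    rintro x ⟨b, hb, hxb⟩ y ⟨c, hc, hyc⟩
    refine ⟨b + c, hTadd b hb c hc, ?_⟩
    rw [map_add, AddSubgroup.coe_add]
    exact add_le_add hxb hyc
  have hCconv : Convex ℝ C := fun x hx y hy s t hs ht _ ↦
    hCadd _ (hCsmul s hs x hx) _ (hCsmul t ht y hy)
  have haC : a ∉ closure C := by
    intro h
    obtain ⟨x, ⟨b, hb, hxb⟩, hax⟩ := Metric.mem_closure_iff.mp h ε hε
    refine hab b hb ?_
    have h1 : (realPart (a - x) : U) ≤ algebraMap ℝ U ε := by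
      refine (IsSelfAdjoint.le_algebraMap_norm_self (realPart (a - x)).2).trans ?_
      refine algebraMap_mono U ?_
      rw [dist_eq_norm] at hax
      exact (realPart.norm_le _).trans hax.le
    have h2 : (realPart a : U) = a := ha.isSelfAdjoint.coe_realPart
    rw [map_sub, AddSubgroup.coe_sub, h2, sub_le_iff_le_add'] at h1
    exact h1.trans (by gcongr)
  obtain ⟨f, u, hfC, hfa⟩ := geometric_hahn_banach_closed_point hCconv.closure isClosed_closure haC
  have h0C : (0 : U) ∈ C := ⟨0, hT0, by simp⟩
  have hu : 0 < u := by simpa using hfC 0 (subset_closure h0C)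
  have hfC' : ∀ x ∈ C, f x ≤ 0 := by
    intro x hx
    by_contra! hpos
    have := hfC _ (subset_closure (hCsmul (u / f x) (by positivity) x hx))
    rw [map_smul, smul_eq_mul, div_mul_cancel₀ _ hpos.ne'] at this
    exact this.false
  have hfpos : ∀ x, 0 ≤ x → 0 ≤ f x := by
    intro x hx
    have := hfC' (-x) ⟨0, hT0, by
      rw [map_neg, AddSubgroup.coe_neg, hx.isSelfAdjoint.coe_realPart]
      exact neg_nonpos.mpr hx⟩
    rw [map_neg] at this
    linarith
  have hfim : ∀ x, IsSelfAdjoint x → f (Complex.I • x) = 0 := by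
    have key : ∀ x, IsSelfAdjoint x → f (Complex.I • x) ≤ 0 := fun x hx ↦
      hfC' _ ⟨0, hT0, by simp [realPart_I_smul, hx.imaginaryPart]⟩
    intro x hx
    refine le_antisymm (key x hx) ?_
    have := key (-x) hx.neg
    rw [smul_neg, map_neg] at this
    linarith
  have hfT : ∀ b ∈ T, f b = 0 := fun b hb ↦ le_antisymm
    (hfC' b ⟨b, hb, by rw [(hTpos b hb).isSelfAdjoint.coe_realPart]⟩) (hfpos b (hTpos b hb))
  have hf1 : 0 < f 1 := by
    refine (hfpos 1 zero_le_one).lt_of_ne fun h1 ↦ ?_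
    have h2 := hfpos _ (sub_nonneg.mpr ha.isSelfAdjoint.le_algebraMap_norm_self)
    rw [map_sub, Algebra.algebraMap_eq_smul_one, map_smul, ← h1] at h2
    simp only [smul_zero] at h2
    linarith
  have hφ : ∀ x, IsSelfAdjoint x → (f.extendRCLike : StrongDual ℂ U) x = f x := by
    intro x hx
    rw [StrongDual.extendRCLike_apply]
    simp [hfim x hx]
  refine ⟨fun x ↦ ((f 1)⁻¹ : ℝ) * (f.extendRCLike : StrongDual ℂ U) x, ⟨fun x y ↦ ?_,
    fun c x ↦ ?_, fun x hx ↦ ?_, ?_, fun b hb ↦ ?_⟩, ?_⟩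
  · simp only [map_add, mul_add]
  · simp only [map_smul, smul_eq_mul]; ring
  · beta_reduce
    rw [hφ x hx.isSelfAdjoint]
    have := hfpos x hx
    exact_mod_cast (by positivity : 0 ≤ (f 1)⁻¹ * f x)
  · beta_reduce
    rw [hφ 1 (.one U)]
    exact_mod_cast inv_mul_cancel₀ hf1.ne'
  · beta_reduce
    rw [hφ b (hTpos b hb).isSelfAdjoint, hfT b hb]
    simp
  · beta_reduce
    rw [hφ a ha.isSelfAdjoint]
    exact_mod_cast (mul_pos (inv_pos.mpr hf1) (hu.trans hfa)).ne'

/-- If `a ≤ b + ε²` and `u` is a suitable local unit for `b`, then `u a u` is close to `a`. -/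
lemma norm_sub_cfc_mul_mul_cfc_le {a b : U} (ha : 0 ≤ a) (hb : 0 ≤ b) {ε : ℝ} (hε : 0 < ε)
    (hab : a ≤ b + algebraMap ℝ U (ε ^ 2)) :
    ‖a - cfc (fun t : ℝ ↦ min (t / ε ^ 2) 1) b * a * cfc (fun t : ℝ ↦ min (t / ε ^ 2) 1) b‖ ≤
      4 * ‖CFC.sqrt a‖ * ε := by
  set f : ℝ → ℝ := fun t ↦ min (t / ε ^ 2) 1
  have hfc : Continuous f := by fun_prop
  have hspec : ∀ t ∈ spectrum ℝ b, 0 ≤ t := fun t ht ↦ spectrum_nonneg_of_nonneg hb ht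
  have hf0 : ∀ t, 0 ≤ t → 0 ≤ f t := fun t ht ↦ le_min (by positivity) zero_le_one
  have hf1 : ∀ t, f t ≤ 1 := fun t ↦ min_le_right _ _
  have hf_eq : ∀ t, 1 ≤ t / ε ^ 2 → f t = 1 := fun t ht ↦ min_eq_right ht
  clear_value f
  set p := cfc f b
  set z := cfc (fun t ↦ 1 - f t) b with hz
  have hp : IsSelfAdjoint p := cfc_predicate f b
  have hzs : IsSelfAdjoint z := cfc_predicate _ b
  have hpz : p = 1 - z := by
    rw [hz, cfc_sub (fun _ ↦ 1) f b, cfc_const_one ℝ b, sub_sub_cancel]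
  have hpn : ‖p‖ ≤ 1 := norm_cfc_le zero_le_one fun t ht ↦ by
    rw [Real.norm_of_nonneg (hf0 t (hspec t ht))]; exact hf1 t
  have hzz : z * z ≤ 1 := by
    rw [hz, ← cfc_mul _ _ b]
    refine cfc_le_one _ _ fun t ht ↦ ?_
    nlinarith [hf0 t (hspec t ht), hf1 t]
  have hzbz : z * b * z ≤ algebraMap ℝ U (ε ^ 2) := by
    have : z * b * z = cfc (fun t ↦ (1 - f t) * t * (1 - f t)) b := by
      rw [cfc_mul (fun t ↦ (1 - f t) * t) _ b, cfc_mul _ (fun t ↦ t) b, cfc_id' ℝ b]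
    rw [this]
    refine cfc_le_algebraMap _ _ b fun t ht ↦ ?_
    have ht0 := hspec t ht
    rcases le_total (t / ε ^ 2) 1 with h | h
    · have h1 : t ≤ ε ^ 2 := by rwa [div_le_one (by positivity)] at h
      have h2 := hf0 t ht0
      have h3 := hf1 t
      have h4 : (1 - f t) * (1 - f t) ≤ 1 := by nlinarith
      nlinarith
    · rw [hf_eq t h]
      simp
      positivity
  have hzaz : z * a * z ≤ algebraMap ℝ U ((2 * ε) ^ 2) := by
    calc z * a * z ≤ z * (b + algebraMap ℝ U (ε ^ 2)) * z := hzs.conjugate_le_conjugate hab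
      _ = z * b * z + (ε ^ 2) • (z * z) := by
          rw [Algebra.algebraMap_eq_smul_one]; simp [mul_add, add_mul]
      _ ≤ algebraMap ℝ U (ε ^ 2) + (ε ^ 2) • 1 := by gcongr
      _ = algebraMap ℝ U (2 * ε ^ 2) := by
          rw [Algebra.algebraMap_eq_smul_one, Algebra.algebraMap_eq_smul_one, ← add_smul]
          ring_nf
      _ ≤ _ := algebraMap_mono U (by nlinarith [sq_nonneg ε])
  set s := CFC.sqrt a with hs
  have hsa : IsSelfAdjoint s := (CFC.sqrt_nonneg a).isSelfAdjoint
  have hss : s * s = a := CFC.sqrt_mul_sqrt_self a ha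
  have hsz : ‖s * z‖ ≤ 2 * ε := by
    refine (sq_le_sq₀ (norm_nonneg _) (by positivity)).mp ?_
    rw [sq, ← CStarRing.norm_star_mul_self, star_mul, hsa.star_eq, hzs.star_eq]
    rw [show z * s * (s * z) = z * a * z by rw [← hss]; noncomm_ring]
    exact (CStarAlgebra.norm_le_iff_le_algebraMap _ (by positivity)
      (hzs.conjugate_nonneg ha)).mpr hzaz
  have hzs' : ‖z * s‖ ≤ 2 * ε := by
    rwa [← norm_star, star_mul, hsa.star_eq, hzs.star_eq]
  have hdecomp : a - p * a * p = s * (s * z) + (z * s) * (s * p) := by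
    rw [hpz, ← hss]; noncomm_ring
  calc ‖a - p * a * p‖ ≤ ‖s‖ * ‖s * z‖ + ‖z * s‖ * (‖s‖ * ‖p‖) := by
        rw [hdecomp]
        refine (norm_add_le _ _).trans (add_le_add (norm_mul_le _ _) ((norm_mul_le _ _).trans ?_))
        gcongr
        exact norm_mul_le _ _
    _ ≤ ‖s‖ * (2 * ε) + (2 * ε) * (‖s‖ * 1) := by gcongr
    _ = _ := by ring

end Separation

section Hereditary

variable {A : Type u} [NonUnitalCStarAlgebra A] [PartialOrder A] [StarOrderedRing A]

open Unitization in
omit [PartialOrder A] [StarOrderedRing A] in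
/-- A unital irreducible representation of the unitization stays irreducible when restricted
to `A`. -/
lemma IsIrredRep.comp_inr {H : Type*} [NormedAddCommGroup H] [InnerProductSpace ℂ H]
    [CompleteSpace H] {π : Unitization ℂ A →⋆ₙₐ[ℂ] (H →L[ℂ] H)}
    (hπ : IsIrredRep (Unitization ℂ A) π) (h1 : π 1 = 1) :
    IsIrredRep A (π.comp (inrNonUnitalStarAlgHom ℂ A)) := by
  refine ⟨hπ.1, fun K hK hinv ↦ hπ.2 K hK fun x v hv ↦ ?_⟩
  induction x using Unitization.ind with
  | inl_add_inr c a =>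
    have hc : (inl c : Unitization ℂ A) = c • 1 := by
      rw [← algebraMap_eq_inl, Algebra.algebraMap_eq_smul_one]
    rw [map_add, hc, map_smul, h1]
    exact K.add_mem (K.smul_mem c hv) (hinv a v hv)

open Unitization in
lemma IsHereditary.mem_of_forall_exists_le {B : NonUnitalStarSubalgebra ℂ A}
    (hB : IsHereditary A B) {a : A} (ha : 0 ≤ a)
    (h : ∀ ε : ℝ, 0 < ε → ∃ b ∈ B, 0 ≤ b ∧
      (a : Unitization ℂ A) ≤ b + algebraMap ℝ (Unitization ℂ A) ε) : a ∈ B := by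
  have : IsClosed (B : Set A) := hB.1
  suffices a ∈ closure (B : Set A) by rwa [hB.1.closure_eq] at this
  rw [Metric.mem_closure_iff]
  intro η hη
  have ha' : (0 : Unitization ℂ A) ≤ a := inr_nonneg_iff.mpr ha
  set M := ‖CFC.sqrt (a : Unitization ℂ A)‖
  set ε := η / (4 * M + 1) with hε_def
  have hM : 0 ≤ M := norm_nonneg _
  have hε : 0 < ε := by positivity
  obtain ⟨b, hbB, hb, hab⟩ := h (ε ^ 2) (by positivity)
  set f : ℝ → ℝ := fun t ↦ min (t / ε ^ 2) 1
  have hf0 : f 0 = 0 := by simp [f]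
  have hu : cfcₙ f b ∈ B := cfcₙ_mem f hbB
  have hus : IsSelfAdjoint (cfcₙ f b) := cfcₙ_predicate f b
  refine ⟨cfcₙ f b * a * cfcₙ f b, ?_, ?_⟩
  · refine hB.2 _ (‖a‖ • (cfcₙ f b * cfcₙ f b)) ?_ (hus.conjugate_nonneg ha) ?_
    · rw [← Complex.coe_smul]
      exact SMulMemClass.smul_mem _ (mul_mem hu hu)
    · have := CStarAlgebra.star_left_conjugate_le_norm_smul (a := cfcₙ f b) (b := a)
        ha.isSelfAdjoint
      rwa [hus.star_eq] at this
  · have key := norm_sub_cfc_mul_mul_cfc_le ha' (inr_nonneg_iff.mpr hb) hε hab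
    rw [← real_cfcₙ_eq_cfc_inr b f hf0, ← inr_mul, ← inr_mul, ← inr_sub, norm_inr] at key
    rw [dist_eq_norm]
    refine key.trans_lt ?_
    change 4 * M * ε < η
    rw [hε_def, mul_div_assoc', div_lt_iff₀ (by positivity)]
    linarith

/-- A positive element outside a hereditary subalgebra `B` is detected by an irreducible
representation having a nonzero vector annihilated by `B`. -/
lemma IsHereditary.exists_isIrredRep_of_notMem {B : NonUnitalStarSubalgebra ℂ A}
    (hB : IsHereditary A B) {a : A} (ha : 0 ≤ a) (haB : a ∉ B) :
    ∃ (H : Type u) (_ : NormedAddCommGroup H) (_ : InnerProductSpace ℂ H) (_ : CompleteSpace H)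
      (π : A →⋆ₙₐ[ℂ] (H →L[ℂ] H)) (ξ : H), IsIrredRep A π ∧ π a ξ ≠ 0 ∧
        ∀ b ∈ B, π b ξ = 0 := by
  have h := mt (hB.mem_of_forall_exists_le ha) haB
  push Not at h
  obtain ⟨ε, hε, h⟩ := h
  set T : Set (Unitization ℂ A) := (↑) '' {b : A | b ∈ B ∧ 0 ≤ b} with hT
  have hTpos : ∀ b ∈ T, 0 ≤ b := by
    rintro _ ⟨b, ⟨-, hb⟩, rfl⟩
    exact Unitization.inr_nonneg_iff.mpr hb
  obtain ⟨f, hf, hfa⟩ := exists_mem_statesVanishingOn_apply_ne_zero (T := T)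
    ⟨0, ⟨zero_mem B, le_rfl⟩, by simp⟩
    (by
      rintro _ ⟨b, ⟨hbB, hb⟩, rfl⟩ _ ⟨c, ⟨hcB, hc⟩, rfl⟩
      exact ⟨b + c, ⟨add_mem hbB hcB, add_nonneg hb hc⟩, by simp⟩)
    (by
      rintro r hr _ ⟨b, ⟨hbB, hb⟩, rfl⟩
      refine ⟨r • b, ⟨?_, smul_nonneg hr hb⟩, by simp⟩
      rw [← Complex.coe_smul]
      exact SMulMemClass.smul_mem _ hbB)
    hTpos (a := (a : Unitization ℂ A)) (Unitization.inr_nonneg_iff.mpr ha) hε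
    (by
      rintro _ ⟨b, ⟨hbB, hb⟩, rfl⟩
      exact h b hbB hb)
  obtain ⟨H, _, _, _, π, ξ, hπ, h1, hne, hvan⟩ :=
    exists_isIrredRep_of_statesVanishingOn hTpos hf hfa
  refine ⟨H, _, _, _, π.comp (Unitization.inrNonUnitalStarAlgHom ℂ A), ξ, hπ.comp_inr h1, ?_, ?_⟩
  · intro h0
    refine hne ?_
    change ⟪ξ, (π.comp (Unitization.inrNonUnitalStarAlgHom ℂ A)) a ξ⟫_ℂ = 0
    rw [h0, inner_zero_right]
  · intro b hb
    have h0 := hvan ((star b * b : A) : Unitization ℂ A)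
      ⟨_, ⟨mul_mem (star_mem hb) hb, star_mul_self_nonneg b⟩, rfl⟩
    change ⟪ξ, (π.comp (Unitization.inrNonUnitalStarAlgHom ℂ A)) (star b * b) ξ⟫_ℂ = 0 at h0
    rwa [map_mul, map_star, ContinuousLinearMap.star_eq_adjoint, mul_apply_eq_comp,
      ContinuousLinearMap.adjoint_inner_right, inner_self_eq_zero] at h0

omit [PartialOrder A] [StarOrderedRing A] in
lemma apply_eq_zero_of_repSpan_eq_top {H : Type*} [NormedAddCommGroup H] [InnerProductSpace ℂ H]
    [CompleteSpace H] (π : A →⋆ₙₐ[ℂ] (H →L[ℂ] H)) (B : NonUnitalStarSubalgebra ℂ A) {ξ : H}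
    (hξ : ∀ b ∈ B, π b ξ = 0) (h : repSpan A π (B : Set A) = ⊤) : ξ = 0 := by
  have hle : repSpan A π (B : Set A) ≤ (ℂ ∙ ξ)ᗮ := by
    refine Submodule.topologicalClosure_minimal _ ?_ (Submodule.isClosed_orthogonal _)
    rw [Submodule.span_le]
    rintro _ ⟨b, hb, x, rfl⟩
    rw [SetLike.mem_coe, Submodule.mem_orthogonal_singleton_iff_inner_right,
      ← ContinuousLinearMap.adjoint_inner_left, ← ContinuousLinearMap.star_eq_adjoint, ← map_star,
      hξ _ (star_mem hb), inner_zero_left]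
  rw [h] at hle
  have := hle (Submodule.mem_top (x := ξ))
  rwa [Submodule.mem_orthogonal_singleton_iff_inner_right, inner_self_eq_zero] at this

omit [PartialOrder A] [StarOrderedRing A] in
lemma repSpan_eq_top_of_forall_mul_mem {H : Type*} [NormedAddCommGroup H]
    [InnerProductSpace ℂ H] [CompleteSpace H] {π : A →⋆ₙₐ[ℂ] (H →L[ℂ] H)} (hπ : IsIrredRep A π)
    {S : Set A} (hS : ∀ a : A, ∀ b ∈ S, a * b ∈ S) (hne : ∃ b ∈ S, π b ≠ 0) :
    repSpan A π S = ⊤ := by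
  have hinv : ∀ a : A, ∀ x ∈ repSpan A π S, π a x ∈ repSpan A π S := by
    intro a
    suffices repSpan A π S ≤ (repSpan A π S).comap (π a : H →ₗ[ℂ] H) from fun x hx ↦ this hx
    refine Submodule.topologicalClosure_minimal _ ?_
      ((Submodule.isClosed_topologicalClosure _).preimage (π a).continuous)
    rw [Submodule.span_le]
    rintro _ ⟨b, hb, x, rfl⟩
    refine Submodule.le_topologicalClosure _ (Submodule.subset_span ⟨a * b, hS a b hb, x, ?_⟩)
    simp
  refine (hπ.2 _ (Submodule.isClosed_topologicalClosure _) hinv).resolve_left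
    fun (hbot : repSpan A π S = ⊥) ↦ ?_
  obtain ⟨b, hb, hbne⟩ := hne
  refine hbne (ContinuousLinearMap.ext fun x ↦ ?_)
  have : π b x ∈ repSpan A π S :=
    Submodule.le_topologicalClosure _ (Submodule.subset_span ⟨b, hb, x, rfl⟩)
  rwa [hbot, Submodule.mem_bot] at this

omit [PartialOrder A] [StarOrderedRing A] in
/-- Polarization: `4 y* z` as a combination of elements `w* w`. -/
lemma four_smul_star_mul (y z : A) :
    (4 : ℂ) • (star y * z) = star (z + y) * (z + y) - star (z - y) * (z - y)
      + Complex.I • (star (z + Complex.I • y) * (z + Complex.I • y))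
      - Complex.I • (star (z - Complex.I • y) * (z - Complex.I • y)) := by
  simp only [star_add, star_sub, star_smul, add_mul, mul_add, sub_mul, mul_sub, smul_add, smul_sub,
    smul_mul_assoc, mul_smul_comm, smul_smul, Complex.star_def, Complex.conj_I]
  simp only [mul_neg, Complex.I_mul_I, neg_neg, one_smul, neg_smul]
  module

omit [PartialOrder A] [StarOrderedRing A] in
/-- In a closed *-subalgebra, self-adjoint elements are products. -/
lemma exists_mul_eq_of_isSelfAdjoint {B : NonUnitalStarSubalgebra ℂ A}
    (hB : IsClosed (B : Set A)) {h : A} (hh : IsSelfAdjoint h) (hhB : h ∈ B) :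
    ∃ c ∈ B, ∃ d ∈ B, h = c * d := by
  refine ⟨cfcₙ (fun t : ℝ ↦ √|t|) h, cfcₙ_mem _ hhB,
    cfcₙ (fun t : ℝ ↦ √(max t 0) - √(max (-t) 0)) h, cfcₙ_mem _ hhB, ?_⟩
  rw [← cfcₙ_mul _ _ h]
  conv_lhs => rw [← cfcₙ_id' ℝ h]
  refine cfcₙ_congr fun t _ ↦ ?_
  rcases le_total 0 t with ht | ht
  · simp [abs_of_nonneg ht, ht]
  · simp [abs_of_nonpos ht, ht]

lemma IsHereditary.mul_mem_of_repSpan_eq_top {B : NonUnitalStarSubalgebra ℂ A}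
    (hB : IsHereditary A B)
    (h : ∀ (H : Type u) [NormedAddCommGroup H] [InnerProductSpace ℂ H] [CompleteSpace H]
        (π : A →⋆ₙₐ[ℂ] (H →L[ℂ] H)), IsIrredRep A π →
          (∃ b ∈ B, π b ≠ 0) → repSpan A π (B : Set A) = ⊤) (x : A) {b : A} (hb : b ∈ B) :
    x * b ∈ B := by
  have hsq : ∀ w : A, (∀ (H : Type u) [NormedAddCommGroup H] [InnerProductSpace ℂ H]
      [CompleteSpace H] (π : A →⋆ₙₐ[ℂ] (H →L[ℂ] H)), (∀ b ∈ B, π b = 0) → π w = 0) →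
      star w * w ∈ B := by
    intro w hw
    by_contra hmem
    obtain ⟨H, _, _, _, π, ξ, hπ, hne, hvan⟩ :=
      hB.exists_isIrredRep_of_notMem (star_mul_self_nonneg w) hmem
    have hπB : ∀ b ∈ B, π b = 0 := by
      by_contra! hπB
      refine hne ?_
      rw [apply_eq_zero_of_repSpan_eq_top π B hvan (h H π hπ hπB), map_zero]
    refine hne ?_
    rw [map_mul, hw H π hπB, mul_zero, zero_apply]
  have hmul : ∀ c ∈ B, ∀ d ∈ B, x * (c * d) ∈ B := by
    intro c hc d hd
    have hπ : ∀ (r : ℂ) (H : Type u) [NormedAddCommGroup H] [InnerProductSpace ℂ H]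
        [CompleteSpace H] (π : A →⋆ₙₐ[ℂ] (H →L[ℂ] H)), (∀ b ∈ B, π b = 0) →
        π (d + r • star (x * c)) = 0 := by
      intro r H _ _ _ π hπB
      simp [hπB d hd, hπB (star c) (star_mem hc)]
    have h4 := four_smul_star_mul (star (x * c)) d
    have hmem : (4 : ℂ) • (star (star (x * c)) * d) ∈ B := by
      rw [h4]
      refine sub_mem (add_mem (sub_mem (hsq _ ?_) (hsq _ ?_))
        (SMulMemClass.smul_mem _ (hsq _ ?_))) (SMulMemClass.smul_mem _ (hsq _ ?_))
      · simpa only [one_smul] using hπ 1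
      · simpa only [neg_smul, one_smul, ← sub_eq_add_neg] using hπ (-1)
      · exact hπ Complex.I
      · simpa only [neg_smul, ← sub_eq_add_neg] using hπ (-Complex.I)
    have := SMulMemClass.smul_mem (4 : ℂ)⁻¹ hmem
    rwa [inv_smul_smul₀ (by norm_num), star_star, mul_assoc] at this
  have hsa : ∀ k ∈ B, IsSelfAdjoint k → x * k ∈ B := by
    intro k hk hks
    obtain ⟨c, hc, d, hd, rfl⟩ := exists_mul_eq_of_isSelfAdjoint hB.1 hks hk
    exact hmul c hc d hd
  have hre : (realPart b : A) ∈ B := by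
    rw [realPart_apply_coe, ← Complex.coe_smul]
    exact SMulMemClass.smul_mem _ (add_mem hb (star_mem hb))
  have him : (imaginaryPart b : A) ∈ B := by
    rw [imaginaryPart_apply_coe, ← Complex.coe_smul]
    exact SMulMemClass.smul_mem _ (SMulMemClass.smul_mem _ (sub_mem hb (star_mem hb)))
  rw [← realPart_add_I_smul_imaginaryPart b, mul_add, mul_smul_comm]
  exact add_mem (hsa _ hre (realPart b).2)
    (SMulMemClass.smul_mem _ (hsa _ him (imaginaryPart b).2))

end Hereditary

/-- A nonzero hereditary C*-subalgebra `B` of `A` is a closed two-sided ideal iff every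
irreducible representation `π` of `A` with `π(B) ≠ 0` satisfies `K_π(B) = H`. -/
theorem hereditary_is_ideal_iff_repSpan_eq_top
    {A : Type u} [NonUnitalNormedRing A] [NormedSpace ℂ A] [StarRing A]
    [CStarRing A] [CompleteSpace A] [IsScalarTower ℂ A A] [SMulCommClass ℂ A A]
    [StarModule ℂ A] [PartialOrder A] [StarOrderedRing A]
    (B : NonUnitalStarSubalgebra ℂ A) (hB : IsHereditary A B)
    (hBne : ∃ b ∈ B, b ≠ (0 : A)) :
    (∀ a : A, ∀ b ∈ B, a * b ∈ B ∧ b * a ∈ B) ↔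
      ∀ (H : Type u) [NormedAddCommGroup H] [InnerProductSpace ℂ H] [CompleteSpace H]
        (π : A →⋆ₙₐ[ℂ] (H →L[ℂ] H)), IsIrredRep A π →
          (∃ b ∈ B, π b ≠ 0) → repSpan A π (B : Set A) = ⊤ := by
  let _ : NonUnitalCStarAlgebra A := { }
  constructor
  · intro hideal H _ _ _ π hπ hne
    exact repSpan_eq_top_of_forall_mul_mem hπ (fun a b hb ↦ (hideal a b hb).1) hne
  · intro h a b hb
    have hmul : ∀ x : A, ∀ c ∈ B, x * c ∈ B := fun x c hc ↦
      IsHereditary.mul_mem_of_repSpan_eq_top hB h x hc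
    refine ⟨hmul a b hb, ?_⟩
    rw [← star_star (b * a), star_mul]
    exact star_mem (hmul _ _ (star_mem hb))
end
end
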